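/- (Convex reformulation, optimal-value equality.) Let N, T, ν, L be positive integers, ρ̄ in the probability simplex of ℝ^N, f a real-valued function of state trajectories (ρ^0, …, ρ^T), c a function mapping a pair of a state trajectory (ρ^0, …, ρ^T) and a matrix trajectory (M^0, …, M^{T-1}) to ℝ^ν, and linear input-constraint data α_l ∈ ℝ^N, β_l ∈ ℝ, time indices t_l ∈ {0, …, T−1}, and column indices j_l ∈ {1, …, N} for l = 1, …, L. Assume there exist Π̄^0, …, Π̄^{T-1} ∈ P^N with ∑_{i=1}^N α_{l,i} Π̄^{t_l}_{(i, j_l)} ≤ β_l for all l. Then the infimum of f(ρ^0, …, ρ^T) over all (ρ^t, Π^t) with each Π^t ∈ P^N, ρ^0 = ρ̄, ρ^{t+1} = Π^t ρ^t, c((ρ^t)_t, (Π^t·diag(ρ^t))_t) ≤ 0 componentwise, and ∑_{i=1}^N α_{l,i} Π^{t_l}_{(i, j_l)} ≤ β_l for all l, equals the infimum of f(ρ^0, …, ρ^T) over all (ρ^t, M^t) with (ρ^t, M^t) ∈ M^N for t = 0, …, T−1, ρ^0 = ρ̄, ρ^{t+1} = M^t · 1_N, c((ρ^t)_t, (M^t)_t)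 ≤ 0 componentwise, and ∑_{i=1}^N α_{l,i} M^{t_l}_{(i, j_l)} ≤ β_l ρ^{t_l}_{j_l} for all l. -/

import Mathlib

/-- The probability simplex `S^N`: vectors in `ℝ^N` with nonnegative entries summing to 1. -/
def probSimplex (N : ℕ) : Set (Fin N → ℝ) :=
  {ρ | (∀ i, 0 ≤ ρ i) ∧ ∑ i, ρ i = 1}

/-- The set `P^N` of valid transition probability matrices: nonnegative entries and
each column sums to 1 (`1ᵀ Π = 1ᵀ`). -/
def validTransMatrices (N : ℕ) : Set (Matrix (Fin N) (Fin N) ℝ) :=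
  {P | (∀ i j, 0 ≤ P i j) ∧ ∀ j, ∑ i, P i j = 1}

/-- The set `M^N` of pairs `(ρ, M)` with `ρ` nonnegative, `M` nonnegative entrywise,
and `1ᵀ M = ρᵀ` (the `j`-th column of `M` sums to `ρ_j`). -/
def jointSet (N : ℕ) : Set ((Fin N → ℝ) × Matrix (Fin N) (Fin N) ℝ) :=
  {p | (∀ i, 0 ≤ p.1 i) ∧ (∀ i j, 0 ≤ p.2 i j) ∧ ∀ j, ∑ i, p.2 i j = p.1 j}

theorem mulVec_nonneg_of_mem_validTransMatrices {N : ℕ} {P : Matrix (Fin N) (Fin N) ℝ}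
    (hP : P ∈ validTransMatrices N) {ρ : Fin N → ℝ} (hρ : ∀ i, 0 ≤ ρ i) (i : Fin N) :
    0 ≤ P.mulVec ρ i := by
  rw [Matrix.mulVec, dotProduct]
  exact Finset.sum_nonneg fun j _ => mul_nonneg (hP.1 i j) (hρ j)

theorem mk_mul_diagonal_mem_jointSet {N : ℕ} {P : Matrix (Fin N) (Fin N) ℝ}
    (hP : P ∈ validTransMatrices N) {ρ : Fin N → ℝ} (hρ : ∀ i, 0 ≤ ρ i) :
    (ρ, P * Matrix.diagonal ρ) ∈ jointSet N := by
  refine ⟨hρ, fun i j => ?_, fun j => ?_⟩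
  · simpa only [Matrix.mul_diagonal] using mul_nonneg (hP.1 i j) (hρ j)
  · simp only [Matrix.mul_diagonal, ← Finset.sum_mul, hP.2 j, one_mul]

theorem mul_diagonal_mulVec_one {N : ℕ} (P : Matrix (Fin N) (Fin N) ℝ) (ρ : Fin N → ℝ) :
    (P * Matrix.diagonal ρ).mulVec (fun _ => (1 : ℝ)) = P.mulVec ρ := by
  ext i
  simp [Matrix.mulVec, dotProduct, Matrix.mul_diagonal]

/-- The transition matrix whose `j`-th column is `M_j / ρ_j` where `ρ_j ≠ 0`, and the `j`-th
column of the fallback matrix `Q` where `ρ_j = 0`. -/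
noncomputable def conditionalMatrix {N : ℕ} (Q : Matrix (Fin N) (Fin N) ℝ) (ρ : Fin N → ℝ)
    (M : Matrix (Fin N) (Fin N) ℝ) : Matrix (Fin N) (Fin N) ℝ :=
  fun i j => if ρ j = 0 then Q i j else M i j / ρ j

theorem conditionalMatrix_mem_validTransMatrices {N : ℕ} {Q M : Matrix (Fin N) (Fin N) ℝ}
    {ρ : Fin N → ℝ} (hQ : Q ∈ validTransMatrices N) (hM : (ρ, M) ∈ jointSet N) :
    conditionalMatrix Q ρ M ∈ validTransMatrices N := by
  refine ⟨fun i j => ?_, fun j => ?_⟩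
  · unfold conditionalMatrix
    split_ifs
    · exact hQ.1 i j
    · exact div_nonneg (hM.2.1 i j) (hM.1 j)
  · by_cases hj : ρ j = 0
    · simpa [conditionalMatrix, hj] using hQ.2 j
    · have hs : ∑ i, M i j = ρ j := hM.2.2 j
      simp [conditionalMatrix, hj, ← Finset.sum_div, hs]

theorem conditionalMatrix_mul_diagonal {N : ℕ} (Q : Matrix (Fin N) (Fin N) ℝ)
    {M : Matrix (Fin N) (Fin N) ℝ} {ρ : Fin N → ℝ} (hM : (ρ, M) ∈ jointSet N) :
    conditionalMatrix Q ρ M * Matrix.diagonal ρ = M := by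
  ext i j
  rw [Matrix.mul_diagonal]
  by_cases hj : ρ j = 0
  · have hs : ∑ i, M i j = 0 := (hM.2.2 j).trans hj
    have hz := (Finset.sum_eq_zero_iff_of_nonneg fun i _ => hM.2.1 i j).1 hs i
      (Finset.mem_univ i)
    simpa [hj] using hz.symm
  · simp [conditionalMatrix, hj]

theorem sum_mul_conditionalMatrix_le {N : ℕ} {Q M : Matrix (Fin N) (Fin N) ℝ} {ρ : Fin N → ℝ}
    {a : Fin N → ℝ} {b : ℝ} {j : Fin N} (hρ : 0 ≤ ρ j) (hQ : ∑ i, a i * Q i j ≤ b)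
    (hM : ∑ i, a i * M i j ≤ b * ρ j) :
    ∑ i, a i * conditionalMatrix Q ρ M i j ≤ b := by
  by_cases hj : ρ j = 0
  · simpa [conditionalMatrix, hj] using hQ
  · simp only [conditionalMatrix, hj, if_false, ← mul_div_assoc, ← Finset.sum_div]
    exact (div_le_iff₀ (lt_of_le_of_ne hρ (Ne.symm hj))).2 hM

/-- Convex reformulation: the optimal value of the constrained MDP problem over
transition matrices `Π^t ∈ P^N` equals the optimal value of the reformulated problem
over joint-probability matrices `M^t` with `(ρ^t, M^t) ∈ M^N`. -/
theorem convex_reformulation_optimal_value_eq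
    (N T ν L : ℕ) (hN : 0 < N) (hT : 0 < T) (hν : 0 < ν) (hL : 0 < L)
    (ρbar : Fin N → ℝ) (hρbar : ρbar ∈ probSimplex N)
    (f : (Fin (T + 1) → Fin N → ℝ) → ℝ)
    (c : (Fin (T + 1) → Fin N → ℝ) → (Fin T → Matrix (Fin N) (Fin N) ℝ) → Fin ν → ℝ)
    (α : Fin L → Fin N → ℝ) (β : Fin L → ℝ) (tl : Fin L → Fin T) (jl : Fin L → Fin N)
    (hfeas : ∃ Pbar : Fin T → Matrix (Fin N) (Fin N) ℝ,
        (∀ t, Pbar t ∈ validTransMatrices N) ∧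
        ∀ l, ∑ i, α l i * Pbar (tl l) i (jl l) ≤ β l) :
    sInf {y : ℝ |
        ∃ (ρ : Fin (T + 1) → Fin N → ℝ) (P : Fin T → Matrix (Fin N) (Fin N) ℝ),
          (∀ t, P t ∈ validTransMatrices N) ∧
          ρ 0 = ρbar ∧
          (∀ t : Fin T, ρ t.succ = (P t).mulVec (ρ t.castSucc)) ∧
          (∀ i : Fin ν, c ρ (fun t => P t * Matrix.diagonal (ρ t.castSucc)) i ≤ 0) ∧
          (∀ l, ∑ i, α l i * P (tl l) i (jl l) ≤ β l) ∧
          y = f ρ} =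
      sInf {y : ℝ |
        ∃ (ρ : Fin (T + 1) → Fin N → ℝ) (M : Fin T → Matrix (Fin N) (Fin N) ℝ),
          (∀ t : Fin T, (ρ t.castSucc, M t) ∈ jointSet N) ∧
          ρ 0 = ρbar ∧
          (∀ t : Fin T, ρ t.succ = (M t).mulVec (fun _ => (1 : ℝ))) ∧
          (∀ i : Fin ν, c ρ M i ≤ 0) ∧
          (∀ l, ∑ i, α l i * M (tl l) i (jl l) ≤ β l * ρ (tl l).castSucc (jl l)) ∧
          y = f ρ} := by
  obtain ⟨Q, hQ, hQl⟩ := hfeas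
  congr 1
  ext y
  constructor
  · rintro ⟨ρ, P, hP, h0, hstep, hc, hl, rfl⟩
    have hρ : ∀ t i, 0 ≤ ρ t i := by
      intro t
      induction t using Fin.induction with
      | zero => rw [h0]; exact hρbar.1
      | succ t ih => rw [hstep]; exact mulVec_nonneg_of_mem_validTransMatrices (hP t) ih
    refine ⟨ρ, fun t => P t * Matrix.diagonal (ρ t.castSucc),
      fun t => mk_mul_diagonal_mem_jointSet (hP t) (hρ _), h0, fun t => ?_, hc, fun l => ?_, rfl⟩
    · rw [mul_diagonal_mulVec_one, hstep]
    · simp only [Matrix.mul_diagonal, ← mul_assoc, ← Finset.sum_mul]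
      exact mul_le_mul_of_nonneg_right (hl l) (hρ _ _)
  · rintro ⟨ρ, M, hM, h0, hstep, hc, hl, rfl⟩
    have hPM : ∀ t : Fin T, conditionalMatrix (Q t) (ρ t.castSucc) (M t) *
        Matrix.diagonal (ρ t.castSucc) = M t :=
      fun t => conditionalMatrix_mul_diagonal (Q t) (hM t)
    refine ⟨ρ, fun t => conditionalMatrix (Q t) (ρ t.castSucc) (M t),
      fun t => conditionalMatrix_mem_validTransMatrices (hQ t) (hM t), h0, fun t => ?_, ?_,
      fun l => sum_mul_conditionalMatrix_le ((hM _).1 _) (hQl l) (hl l), rfl⟩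
    · rw [hstep, ← mul_diagonal_mulVec_one _ (ρ t.castSucc), hPM]
    · simpa only [hPM] using hc
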